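/- Let 1 < p < ∞ and δ > 1, and let t*(p,δ) be the unique solution x > p of (δx/(x−1))^p · (x−p)/x = 1. If p ≤ t < t*(p,δ), then every weight w ∈ RH_p^δ(I) on a bounded interval I ⊂ ℝ satisfies, for every subinterval J ⊂ I, ⟨w^t⟩_J^{1/t} ≤ ((t*(p,δ) − 1)/t*(p,δ)) · (t*(p,δ)/(t*(p,δ) − t))^{1/t} · ⟨w⟩_J, and this constant is sharp. -/

import Mathlib

open MeasureTheory Set ENNReal

/-- The average `⟨f⟩_{(a,b)}` of an `ℝ≥0∞`-valued function over an interval. -/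
noncomputable def avgE (f : ℝ → ℝ≥0∞) (a b : ℝ) : ℝ≥0∞ :=
  (∫⁻ t in Set.Ioo a b, f t) / ENNReal.ofReal (b - a)

/-- `w ∈ RH_p^δ([A,B])`. -/
def MemRH (p δ A B : ℝ) (w : ℝ → ℝ≥0∞) : Prop :=
  Measurable w ∧ (∫⁻ t in Set.Ioo A B, w t) ≠ ⊤ ∧
    ∀ a b, A ≤ a → a < b → b ≤ B →
      avgE (fun t => w t ^ p) a b ≤ ENNReal.ofReal δ ^ p * (avgE w a b) ^ p

/-- The points of `(c, b)` from which `F` takes a larger value further right in the interval, as in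
the rising sun lemma. -/
def risingSet (F : ℝ → ℝ) (c b : ℝ) : Set ℝ := {x | x ∈ Ioo c b ∧ ∃ y ∈ Ioc x b, F x < F y}

lemma isOpen_risingSet {F : ℝ → ℝ} (hF : Continuous F) (c b : ℝ) : IsOpen (risingSet F c b) := by
  have h : risingSet F c b = Ioo c b ∩ ⋃ y ∈ Iic b, (Iio y ∩ {x | F x < F y}) := by
    ext x
    simp only [risingSet, mem_ofPred_eq, mem_inter_iff, mem_iUnion, mem_Iic, mem_Iio, mem_Ioc,
      exists_prop]
    grind
  rw [h]
  exact isOpen_Ioo.inter <| isOpen_biUnion fun y _ =>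
    isOpen_Iio.inter (isOpen_lt hF continuous_const)

lemma eq_endpoints_of_Ioo_subset_risingSet {F : ℝ → ℝ} (hF : Continuous F) {c b α β : ℝ}
    (hc : ∀ y ∈ Icc c b, F y ≤ F c) (hα : c ≤ α) (hαβ : α < β) (hβ : β ≤ b)
    (hαE : α ∉ risingSet F c b) (hβE : β ∉ risingSet F c b)
    (hsub : Ioo α β ⊆ risingSet F c b) : F α = F β := by
  apply le_antisymm
  · have key : ∀ x ∈ Ioo α β, F x ≤ F β := by
      intro x hx
      by_contra! hlt
      obtain ⟨z, hz, hmax⟩ := isCompact_Icc.exists_isMaxOn (nonempty_Icc.2 hx.2.le)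
        (hF.continuousOn (s := Icc x β))
      have hxz : F x ≤ F z := hmax (left_mem_Icc.2 hx.2.le)
      have hzβ : z < β := lt_of_le_of_ne hz.2 (by rintro rfl; linarith)
      obtain ⟨-, y, hy, hzy⟩ := hsub ⟨hx.1.trans_le hz.1, hzβ⟩
      rcases le_or_gt y β with hyβ | hyβ
      · have : F y ≤ F z := hmax ⟨hz.1.trans hy.1.le, hyβ⟩
        linarith
      · exact hβE ⟨⟨by linarith, by linarith [hy.2]⟩, y, ⟨hyβ, hy.2⟩, by linarith⟩
    have hcl : closure (Ioo α β) ⊆ {x | F x ≤ F β} :=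
      closure_minimal key (isClosed_le hF continuous_const)
    rw [closure_Ioo hαβ.ne] at hcl
    exact hcl (left_mem_Icc.2 hαβ.le)
  · rcases hα.eq_or_lt with rfl | hα
    · exact hc β ⟨hαβ.le, hβ⟩
    · by_contra! h
      exact hαE ⟨⟨hα, by linarith⟩, β, ⟨hαβ, hβ⟩, h⟩

lemma exists_connectedComponentIn_risingSet_eq_Ioo {F : ℝ → ℝ} (hF : Continuous F) {c b x : ℝ}
    (hc : ∀ y ∈ Icc c b, F y ≤ F c) (hx : x ∈ risingSet F c b) :
    ∃ α β, c ≤ α ∧ α < β ∧ β ≤ b ∧ F α = F β ∧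
      connectedComponentIn (risingSet F c b) x = Ioo α β := by
  set E := risingSet F c b with hE
  set C := connectedComponentIn E x with hC
  have hCE : C ⊆ E := connectedComponentIn_subset E x
  have hopen : IsOpen C := (isOpen_risingSet hF c b).connectedComponentIn
  have hxC : x ∈ C := mem_connectedComponentIn hx
  have hconn : IsConnected C := ⟨⟨x, hxC⟩, isPreconnected_connectedComponentIn⟩
  have hCI : C ⊆ Ioo c b := fun y hy => (hCE hy).1
  have hbb : BddBelow C := ⟨c, fun y hy => (hCI hy).1.le⟩
  have hba : BddAbove C := ⟨b, fun y hy => (hCI hy).2.le⟩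
  have hle : ∀ y ∈ C, sInf C < y ∧ y < sSup C := by
    intro y hy
    obtain ⟨ε, hε, hball⟩ := Metric.isOpen_iff.1 hopen y hy
    rw [Real.ball_eq_Ioo] at hball
    have h1 := csInf_le hbb (hball (show y - ε / 2 ∈ _ by constructor <;> linarith))
    have h2 := le_csSup hba (hball (show y + ε / 2 ∈ _ by constructor <;> linarith))
    constructor <;> linarith
  have hCeq : C = Ioo (sInf C) (sSup C) :=
    Subset.antisymm (fun y hy => hle y hy) (hconn.Ioo_csInf_csSup_subset hbb hba)
  have hαβ : sInf C < sSup C := (hle x hxC).1.trans (hle x hxC).2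
  have hnot : ∀ z ∈ Icc (sInf C) (sSup C), z ∈ E → z ∈ C := by
    intro z hz hzE
    have hpre : IsPreconnected (insert z C) := by
      refine hconn.isPreconnected.subset_closure (subset_insert _ _) ?_
      refine insert_subset ?_ subset_closure
      rw [hCeq, closure_Ioo hαβ.ne]
      exact hz
    exact hpre.subset_connectedComponentIn (mem_insert_of_mem _ hxC)
      (insert_subset hzE hCE) (mem_insert _ _)
  have hα : c ≤ sInf C := le_csInf ⟨x, hxC⟩ fun y hy => (hCI hy).1.le
  have hβ : sSup C ≤ b := csSup_le ⟨x, hxC⟩ fun y hy => (hCI hy).2.le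
  refine ⟨sInf C, sSup C, hα, hαβ, hβ, ?_, hCeq⟩
  refine eq_endpoints_of_Ioo_subset_risingSet hF hc hα hαβ hβ ?_ ?_ (hCeq ▸ hCE)
  · exact fun h => lt_irrefl _ (hle _ (hnot _ (left_mem_Icc.2 hαβ.le) h)).1
  · exact fun h => lt_irrefl _ (hle _ (hnot _ (right_mem_Icc.2 hαβ.le) h)).2

lemma setIntegral_risingSet_nonpos {F g : ℝ → ℝ} (hF : Continuous F) {c b : ℝ}
    (hc : ∀ y ∈ Icc c b, F y ≤ F c) (hg : IntegrableOn g (Ioo c b))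
    (h : ∀ α β, c ≤ α → α < β → β ≤ b → F α = F β → ∫ x in Ioo α β, g x ≤ 0) :
    ∫ x in risingSet F c b, g x ≤ 0 := by
  set E := risingSet F c b with hE
  let S : Set (Set ℝ) := connectedComponentIn E '' E
  have hopen : ∀ s ∈ S, IsOpen s := by
    rintro _ ⟨x, hx, rfl⟩
    exact (isOpen_risingSet hF c b).connectedComponentIn
  have hdisj : S.PairwiseDisjoint id := by
    rintro _ ⟨x, hx, rfl⟩ _ ⟨y, hy, rfl⟩ hne
    rw [Function.onFun, id, id, Set.disjoint_left]
    intro z hzx hzy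
    exact hne ((connectedComponentIn_eq hzx).trans (connectedComponentIn_eq hzy).symm)
  have hcount : S.Countable := by
    refine hdisj.countable_of_isOpen hopen ?_
    rintro _ ⟨x, hx, rfl⟩
    exact ⟨x, mem_connectedComponentIn hx⟩
  have hU : E = ⋃ s : S, (s : Set ℝ) := by
    ext x
    simp only [mem_iUnion]
    constructor
    · intro hx
      exact ⟨⟨_, x, hx, rfl⟩, mem_connectedComponentIn hx⟩
    · rintro ⟨⟨_, y, hy, rfl⟩, hx⟩
      exact connectedComponentIn_subset _ _ hx
  have : Countable S := hcount
  have hEI : E ⊆ Ioo c b := fun x hx => hx.1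
  rw [hU, integral_iUnion (s := fun s : S => (s : Set ℝ)) (fun s => (hopen s s.2).measurableSet)]
  · refine tsum_nonpos ?_
    rintro ⟨_, x, hx, rfl⟩
    obtain ⟨α, β, h1, h2, h3, h4, h5⟩ := exists_connectedComponentIn_risingSet_eq_Ioo hF hc hx
    simp only [hE, h5]
    exact h α β h1 h2 h3 h4
  · intro s t hst
    exact hdisj s.2 t.2 (fun h => hst (Subtype.ext h))
  · rw [← hU]
    exact hg.mono_set hEI

lemma ae_le_of_notMem_risingSet {v : ℝ → ℝ} (hv : Integrable v) (l a c b : ℝ) :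
    ∀ᵐ x, x ∈ Ioo c b \ risingSet (fun x => (∫ s in a..x, v s) - l * (x - a)) c b → v x ≤ l := by
  filter_upwards [_root_.LocallyIntegrable.ae_hasDerivAt_integral hv.locallyIntegrable] with x hx hmem
  have hd : HasDerivAt (fun x => (∫ s in a..x, v s) - l * (x - a)) (v x - l) x := by
    have := (hx a).sub (((hasDerivAt_id x).sub_const a).const_mul l)
    rw [mul_one] at this
    exact this
  have ht := (hasDerivWithinAt_iff_tendsto_slope' self_notMem_Ioi).1
    (hd.hasDerivWithinAt (s := Ioi x))
  have : v x - l ≤ 0 := by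
    refine le_of_tendsto ht ?_
    filter_upwards [Ioo_mem_nhdsGT hmem.1.2] with y hy
    rw [slope_def_field]
    refine div_nonpos_of_nonpos_of_nonneg ?_ (by linarith [hy.1])
    by_contra! hlt
    exact hmem.2 ⟨hmem.1, y, ⟨hy.1, hy.2.le⟩, by linarith⟩
  linarith

/-- If the average of `v` over `(a, b)` is at most `l`, then an integral inequality known on all
subintervals over which `v` has average exactly `l` passes to `(a, b)` after modification
of the integrand on `{v ≤ l}`. -/
lemma setIntegral_nonpos_of_average_eq {v g g' : ℝ → ℝ} (hv : Integrable v) {l a b : ℝ}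
    (hab : a < b) (hl : ∫ x in Ioo a b, v x ≤ l * (b - a))
    (hg : IntegrableOn g (Ioo a b)) (hg' : IntegrableOn g' (Ioo a b))
    (hle : ∀ x, g' x ≤ g x) (hle' : ∀ x, v x ≤ l → g' x ≤ 0)
    (h : ∀ α β, a ≤ α → α < β → β ≤ b → ∫ x in Ioo α β, v x = l * (β - α) →
      ∫ x in Ioo α β, g x ≤ 0) :
    ∫ x in Ioo a b, g' x ≤ 0 := by
  set F : ℝ → ℝ := fun x => (∫ s in a..x, v s) - l * (x - a) with hFdef
  have hvi : ∀ x y, IntervalIntegrable v volume x y := fun x y => hv.intervalIntegrable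
  have hF : Continuous F :=
    (intervalIntegral.continuous_primitive hvi a).sub (by fun_prop)
  have hFa : F a = 0 := by simp [hFdef]
  have hFsub : ∀ α β, α ≤ β → ∫ x in Ioo α β, v x = F β - F α + l * (β - α) := by
    intro α β hαβ
    rw [← integral_Ioc_eq_integral_Ioo, ← intervalIntegral.integral_of_le hαβ, hFdef]
    have := intervalIntegral.integral_add_adjacent_intervals (hvi a α) (hvi α β)
    simp only
    linarith
  have hFb : F b ≤ 0 := by
    have := hFsub a b hab.le
    linarith
  have h' : ∀ α β, a ≤ α → α < β → β ≤ b → F α = F β → ∫ x in Ioo α β, g x ≤ 0 := by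
    intro α β h1 h2 h3 h4
    exact h α β h1 h2 h3 (by rw [hFsub α β h2.le, h4]; ring)
  obtain ⟨c, ⟨⟨hac, hcb⟩, hc0⟩, hcmax⟩ :
      ∃ c, IsGreatest (Icc a b ∩ {x | 0 ≤ F x}) c :=
    (isCompact_Icc.inter_right (isClosed_le continuous_const hF)).exists_isGreatest
      ⟨a, left_mem_Icc.2 hab.le, hFa.ge⟩
  have hc0 : 0 ≤ F c := hc0
  have hFc : F c = 0 := by
    obtain ⟨y, hy, hy0⟩ := intermediate_value_Icc' hcb hF.continuousOn ⟨hFb, hc0⟩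
    have hyc : y ≤ c := hcmax ⟨⟨hac.trans hy.1, hy.2⟩, hy0.ge⟩
    rwa [le_antisymm hyc hy.1] at hy0
  have hFle : ∀ y ∈ Icc c b, F y ≤ F c := by
    intro y hy
    by_contra! hlt
    have hyc : y ≤ c := hcmax ⟨⟨hac.trans hy.1, hy.2⟩, by
      change 0 ≤ F y
      linarith⟩
    rw [le_antisymm hyc hy.1] at hlt
    exact lt_irrefl _ hlt
  have hsub1 : Ioo a c ⊆ Ioo a b := Ioo_subset_Ioo_right hcb
  have hsub2 : Ioo c b ⊆ Ioo a b := Ioo_subset_Ioo_left hac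
  have hsplit : ∫ x in Ioo a b, g' x = (∫ x in Ioo a c, g' x) + ∫ x in Ioo c b, g' x := by
    simp only [← integral_Ioc_eq_integral_Ioo]
    rw [← Ioc_union_Ioc_eq_Ioc hac hcb, setIntegral_union (Ioc_disjoint_Ioc_of_le le_rfl)
      measurableSet_Ioc ((integrableOn_Ioc_iff_integrableOn_Ioo (by simp)).2 (hg'.mono_set hsub1))
      ((integrableOn_Ioc_iff_integrableOn_Ioo (by simp)).2 (hg'.mono_set hsub2))]
  have h1 : ∫ x in Ioo a c, g' x ≤ 0 := by
    rcases hac.eq_or_lt with rfl | hac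
    · simp
    · exact (setIntegral_mono (hg'.mono_set hsub1) (hg.mono_set hsub1) hle).trans
        (h' a c le_rfl hac hcb (by rw [hFa, hFc]))
  set E := risingSet F c b with hE
  have hEm : MeasurableSet E := (isOpen_risingSet hF c b).measurableSet
  have hEI : E ⊆ Ioo c b := fun x hx => hx.1
  have h2 : ∫ x in E, g' x ≤ 0 :=
    (setIntegral_mono (hg'.mono_set (hEI.trans hsub2)) (hg.mono_set (hEI.trans hsub2)) hle).trans
      (setIntegral_risingSet_nonpos hF hFle (hg.mono_set hsub2)
        fun α β h1 h2 h3 h4 => h' α β (hac.trans h1) h2 h3 h4)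
  have h3 : ∫ x in Ioo c b \ E, g' x ≤ 0 := by
    refine setIntegral_nonpos_ae (measurableSet_Ioo.diff hEm) ?_
    filter_upwards [ae_le_of_notMem_risingSet hv l a c b] with x hx hmem
    exact hle' x (hx hmem)
  have h4 := integral_inter_add_sdiff (μ := volume) (f := g') hEm (hg'.mono_set hsub2)
  rw [inter_eq_right.2 hEI] at h4
  linarith

/-- The height of `u ^ p` above the tangent line at `l` of the curve `D * u ^ p`. -/
noncomputable def tangentGap (p D l u : ℝ) : ℝ :=
  u ^ p + (p - 1) * D * l ^ p - p * D * l ^ (p - 1) * u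

/-- An antiderivative in `l` of `tangentGap p D l u * l ^ (t - p - 1)`. -/
noncomputable def tangentGapPrim (p D t l u : ℝ) : ℝ :=
  l ^ (t - p) * u ^ p / (t - p) + (p - 1) * D * l ^ t / t - p * D * u * l ^ (t - 1) / (t - 1)

section Gap

variable {p D k t l u : ℝ}

lemma convexOn_tangentGap (hp : 1 < p) (D l : ℝ) :
    ConvexOn ℝ (Ici 0) (fun u => tangentGap p D l u) := by
  have h1 := convexOn_rpow hp.le
  refine ⟨convex_Ici 0, fun x hx y hy a b ha hb hab => ?_⟩
  have h2 := h1.2 hx hy ha hb hab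
  simp only [tangentGap, smul_eq_mul] at *
  have hb' : b = 1 - a := by linarith
  subst hb'
  linarith

lemma tangentGap_mul_self (hl : 0 < l) (hk0 : 0 < k) (hk : k ^ p = D * (1 - p * (1 - k))) :
    tangentGap p D l (k * l) = 0 := by
  rw [tangentGap, Real.mul_rpow hk0.le hl.le, hk]
  have : l ^ p = l ^ (p - 1) * l := by rw [← Real.rpow_add_one hl.ne']; ring_nf
  rw [this]; ring

lemma tangentGap_self_neg (hl : 0 < l) (hD : 1 < D) : tangentGap p D l l < 0 := by
  have h1 : l ^ p = l ^ (p - 1) * l := by rw [← Real.rpow_add_one hl.ne']; ring_nf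
  have h2 : tangentGap p D l l = -((D - 1) * l ^ p) := by rw [tangentGap, h1]; ring
  have := mul_pos (sub_pos.2 hD) (Real.rpow_pos_of_pos hl p)
  linarith

lemma tangentGap_nonneg (hp : 1 < p) (hD : 1 < D) (hk0 : 0 < k) (hk1 : k < 1)
    (hk : k ^ p = D * (1 - p * (1 - k))) (hl : 0 < l) (hu : 0 ≤ u) (huk : u ≤ k * l) :
    0 ≤ tangentGap p D l u := by
  have h := (convexOn_tangentGap hp D l).le_max_of_mem_Icc hu hl.le
    ⟨huk, (mul_lt_of_lt_one_left hl hk1).le⟩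
  rw [tangentGap_mul_self hl hk0 hk] at h
  exact (le_max_iff.1 h).resolve_right (tangentGap_self_neg hl hD).not_ge

lemma tangentGap_nonpos (hp : 1 < p) (hD : 1 < D) (hk0 : 0 < k)
    (hk : k ^ p = D * (1 - p * (1 - k))) (hl : 0 < l) (huk : k * l ≤ u) (hul : u ≤ l) :
    tangentGap p D l u ≤ 0 := by
  have h := (convexOn_tangentGap hp D l).le_max_of_mem_Icc (mul_pos hk0 hl).le hl.le
    ⟨huk, hul⟩
  rw [tangentGap_mul_self hl hk0 hk] at h
  exact h.trans (max_le le_rfl (tangentGap_self_neg hl hD).le)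

lemma hasDerivAt_tangentGapPrim (hp : 1 < p) (hpt : p < t) (hl : 0 < l) :
    HasDerivAt (fun l => tangentGapPrim p D t l u) (tangentGap p D l u * l ^ (t - p - 1)) l := by
  have h (r : ℝ) := Real.hasDerivAt_rpow_const (x := l) (p := r) (Or.inl hl.ne')
  have h1 := ((((h (t - p)).mul_const (u ^ p)).div_const (t - p)).add
    (((h t).const_mul ((p - 1) * D)).div_const t)).sub
    (((h (t - 1)).const_mul (p * D * u)).div_const (t - 1))
  refine h1.congr_deriv ?_
  have e1 : l ^ p * l ^ (t - p - 1) = l ^ (t - 1) := by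
    rw [← Real.rpow_add hl]; ring_nf
  have e2 : l ^ (p - 1) * l ^ (t - p - 1) = l ^ (t - 1 - 1) := by
    rw [← Real.rpow_add hl]; ring_nf
  have h1 : t - p ≠ 0 := by linarith
  have h2 : t ≠ 0 := by linarith
  have h3 : t - 1 ≠ 0 := by linarith
  rw [tangentGap, ← e1, ← e2]
  field_simp

lemma continuousOn_tangentGap_mul (p D t u : ℝ) :
    ContinuousOn (fun l => tangentGap p D l u * l ^ (t - p - 1)) (Ioi 0) := by
  have h (r : ℝ) : ContinuousOn (fun l : ℝ => l ^ r) (Ioi 0) :=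
    fun x hx => (Real.continuousAt_rpow_const x r (Or.inl (ne_of_gt hx))).continuousWithinAt
  unfold tangentGap
  exact ((continuousOn_const.add (continuousOn_const.mul (h p))).sub
    ((continuousOn_const.mul (h (p - 1))).mul continuousOn_const)).mul (h _)

lemma integral_tangentGap_mul (hp : 1 < p) (hpt : p < t) {l₀ l₁ : ℝ} (hl₀ : 0 < l₀)
    (h : l₀ ≤ l₁) :
    ∫ l in Ioc l₀ l₁, tangentGap p D l u * l ^ (t - p - 1)
      = tangentGapPrim p D t l₁ u - tangentGapPrim p D t l₀ u := by
  rw [← intervalIntegral.integral_of_le h]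
  have hsub : uIcc l₀ l₁ ⊆ Ioi 0 := by
    rw [uIcc_of_le h]
    exact fun x hx => hl₀.trans_le hx.1
  exact intervalIntegral.integral_eq_sub_of_hasDerivAt
    (fun x hx => hasDerivAt_tangentGapPrim hp hpt (hsub hx))
    ((continuousOn_tangentGap_mul p D t u).mono hsub).intervalIntegrable

lemma tangentGapPrim_nonneg (hp : 1 < p) (hpt : p < t) (hl : 0 < l) (hu : 0 ≤ u)
    (hD0 : 0 ≤ D) (hD : D ≤ ((t - 1) / t) ^ p * (t / (t - p))) : 0 ≤ tangentGapPrim p D t l u := by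
  have ht : 0 < t := by linarith
  have ht1 : 0 < t - 1 := by linarith
  have htp : 0 < t - p := by linarith
  set c := (t - 1) / t with hc
  have hc0 : 0 < c := div_pos ht1 ht
  have e1 : l ^ t = l ^ (t - p) * l ^ p := by rw [← Real.rpow_add hl]; ring_nf
  have e2 : l ^ (t - 1) = l ^ (t - p) * l ^ p / l := by rw [← e1, Real.rpow_sub_one hl.ne']
  set y := u / (c * l) with hy
  have hy0 : 0 ≤ y := by positivity
  have hu' : u = c * y * l := by rw [hy]; field_simp
  have hup : u ^ p = c ^ p * y ^ p * l ^ p := by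
    rw [hu', Real.mul_rpow (by positivity) hl.le, Real.mul_rpow hc0.le hy0]
  have hb := one_add_mul_self_le_rpow_one_add (s := y - 1) (by linarith) hp.le
  rw [add_sub_cancel] at hb
  have key : tangentGapPrim p D t l u = l ^ (t - p) * l ^ p *
      (c ^ p * y ^ p / (t - p) + D * ((p - 1) - p * y) / t) := by
    rw [tangentGapPrim, e1, e2, hup]
    have : p * D * u * (l ^ (t - p) * l ^ p / l) / (t - 1) =
        l ^ (t - p) * l ^ p * (D * p * y / t) := by
      rw [hu', hc]; field_simp
    rw [this]; field_simp; ring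
  rw [key]
  refine mul_nonneg (by positivity) ?_
  have hcp : 0 < c ^ p := by positivity
  rcases le_total 0 ((p - 1) - p * y) with h | h
  · positivity
  · have h6 : c ^ p * (t / (t - p)) * (p - 1 - p * y) ≤ D * (p - 1 - p * y) :=
      mul_le_mul_of_nonpos_right hD h
    calc 0 ≤ c ^ p * (y ^ p - (1 + p * (y - 1))) / (t - p) := by
          have : 0 ≤ y ^ p - (1 + p * (y - 1)) := by linarith
          positivity
      _ = c ^ p * y ^ p / (t - p) + c ^ p * (t / (t - p)) * (p - 1 - p * y) / t := by
          field_simp; ring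
      _ ≤ _ := by gcongr

lemma tangentGapPrim_slope (hp : 1 < p) (hpt : p < t) {s : ℝ} (hts : t < s)
    (hkp : ((s - 1) / s) ^ p = D * (1 - p * (1 - (s - 1) / s))) (hl : 0 < l) :
    tangentGapPrim p D t l ((s - 1) / s * l)
      = D * p * (p - 1) * (s - t) / (s * t * (t - p) * (t - 1)) * l ^ t := by
  have ht : 0 < t := by linarith
  have ht1 : 0 < t - 1 := by linarith
  have htp : 0 < t - p := by linarith
  have hs : 0 < s := by linarith
  have hs1 : 0 < s - 1 := by linarith
  have e1 : l ^ t = l ^ (t - p) * l ^ p := by rw [← Real.rpow_add hl]; ring_nf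
  have e2 : l ^ (t - 1) = l ^ (t - p) * l ^ p / l := by rw [← e1, Real.rpow_sub_one hl.ne']
  rw [tangentGapPrim, Real.mul_rpow (by positivity) hl.le, hkp, e1, e2]
  field_simp
  ring

/-- The map `x ↦ (x / (x - 1)) ^ p * ((x - p) / x)` is increasing, in a form solved for `D`. -/
lemma le_of_critical_exponent (hp : 1 < p) (hpt : p < t) {s : ℝ} (hts : t < s)
    (hkp : ((s - 1) / s) ^ p = D * (1 - p * (1 - (s - 1) / s))) :
    D ≤ ((t - 1) / t) ^ p * (t / (t - p)) := by
  have ht : 0 < t := by linarith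
  have ht1 : 0 < t - 1 := by linarith
  have htp : 0 < t - p := by linarith
  have hs : 0 < s := by linarith
  have hs1 : 0 < s - 1 := by linarith
  have hsp : 0 < s - p := by linarith
  set k := (s - 1) / s with hk
  have hk0 : 0 < k := by positivity
  set y := (t - 1) / t / k with hy
  have hy0 : 0 < y := by positivity
  have hyk : (t - 1) / t = y * k := by rw [hy]; field_simp
  have hb := one_add_mul_self_le_rpow_one_add (s := y - 1) (by linarith) hp.le
  rw [add_sub_cancel] at hb
  have e : 1 - p * (1 - k) = (s - p) / s := by rw [hk]; field_simp; ring
  have hD0 : 0 < D := by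
    have : 0 < D * ((s - p) / s) := by rw [← e, ← hkp]; positivity
    exact (pos_iff_pos_of_mul_pos this).2 (by positivity)
  rw [hyk, Real.mul_rpow hy0.le hk0.le, hkp, e]
  have h1 : 1 ≤ (1 + p * (y - 1)) * ((s - p) / s) * (t / (t - p)) := by
    have : (1 + p * (y - 1)) * ((s - p) / s) * (t / (t - p)) - 1
        = p * (p - 1) * (s - t) / ((s - 1) * s * (t - p)) := by
      rw [hy, hk]; field_simp; ring
    have : 0 < p * (p - 1) * (s - t) / ((s - 1) * s * (t - p)) := by
      have := sub_pos.2 hp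
      have := sub_pos.2 hts
      positivity
    linarith
  calc D ≤ D * ((1 + p * (y - 1)) * ((s - p) / s) * (t / (t - p))) :=
        le_mul_of_one_le_right hD0.le h1
    _ ≤ D * (y ^ p * ((s - p) / s) * (t / (t - p))) := by gcongr
    _ = _ := by ring

lemma le_integral_tangentGap_indicator (hp : 1 < p) (hpt : p < t) (hD : 1 < D)
    (hk0 : 0 < k) (hk1 : k < 1) (hk : k ^ p = D * (1 - p * (1 - k)))
    (hD' : D ≤ ((t - 1) / t) ^ p * (t / (t - p))) {q : ℝ}
    (hq : ∀ l, 0 < l → tangentGapPrim p D t l (k * l) = q * (k * l) ^ t)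
    {l₀ N : ℝ} (hl₀ : 0 < l₀) (hN : l₀ ≤ N) (hu : 0 ≤ u) :
    (if u ≤ k * N then q * u ^ t else 0) - tangentGapPrim p D t l₀ u
      ≤ ∫ l in Ioc l₀ N, if k * l ≤ u then tangentGap p D l u * l ^ (t - p - 1) else 0 := by
  have hD0 : 0 ≤ D := by linarith
  have ht : 0 < t := by linarith
  rcases lt_or_ge u (k * l₀) with hlt | hge
  · have hz : ∫ l in Ioc l₀ N, (if k * l ≤ u then tangentGap p D l u * l ^ (t - p - 1) else 0)
        = 0 := by
      refine setIntegral_eq_zero_of_forall_eq_zero fun l hl => if_neg ?_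
      have := mul_lt_mul_of_pos_left hl.1 hk0
      linarith
    rw [hz, if_pos (hlt.le.trans (mul_le_mul_of_nonneg_left hN hk0.le)), sub_nonpos]
    rcases hu.eq_or_lt with rfl | hu
    · rw [Real.zero_rpow ht.ne', mul_zero]
      exact tangentGapPrim_nonneg hp hpt hl₀ le_rfl hD0 hD'
    · have hM : 0 < u / k := div_pos hu hk0
      have hkM : k * (u / k) = u := by field_simp
      have hMl : u / k ≤ l₀ := by rw [div_le_iff₀ hk0]; linarith
      have h1 := integral_tangentGap_mul (D := D) (u := u) hp hpt hM hMl
      have h2 := hq _ hM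
      rw [hkM] at h2
      have h3 : 0 ≤ ∫ l in Ioc (u / k) l₀, tangentGap p D l u * l ^ (t - p - 1) := by
        refine setIntegral_nonneg measurableSet_Ioc fun l hl => ?_
        have hl0 : 0 < l := hM.trans hl.1
        refine mul_nonneg (tangentGap_nonneg hp hD hk0 hk1 hk hl0 hu.le ?_)
          (Real.rpow_nonneg hl0.le _)
        have := (div_lt_iff₀ hk0).1 hl.1
        linarith
      linarith
  · have key : ∀ m, l₀ ≤ m → m ≤ N → k * m ≤ u → (m = N ∨ u = k * m) →
        ∫ l in Ioc l₀ N, (if k * l ≤ u then tangentGap p D l u * l ^ (t - p - 1) else 0)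
          = tangentGapPrim p D t m u - tangentGapPrim p D t l₀ u := by
      intro m h1 h2 h3 h4
      rw [← integral_tangentGap_mul hp hpt hl₀ h1]
      symm
      rw [← setIntegral_congr_fun (s := Ioc l₀ m)
        (f := fun l => if k * l ≤ u then tangentGap p D l u * l ^ (t - p - 1) else 0)
        measurableSet_Ioc]
      · symm
        refine setIntegral_eq_of_subset_of_forall_sdiff_eq_zero measurableSet_Ioc
          (Ioc_subset_Ioc_right h2) ?_
        rintro l ⟨hl, hl'⟩
        refine if_neg ?_
        have hml : m < l := by
          by_contra! h
          exact hl' ⟨hl.1, h⟩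
        rcases h4 with rfl | rfl
        · exact absurd hl.2 hml.not_ge
        · have := mul_lt_mul_of_pos_left hml hk0
          linarith
      · intro l hl
        exact if_pos ((mul_le_mul_of_nonneg_left hl.2 hk0.le).trans h3)
    rcases le_or_gt u (k * N) with hle | hgt
    · have hkM : k * (u / k) = u := by field_simp
      have hM : l₀ ≤ u / k := by rw [le_div_iff₀ hk0]; linarith
      rw [key (u / k) hM (by rw [div_le_iff₀ hk0]; linarith) hkM.le (Or.inr hkM.symm), if_pos hle]
      have h2 := hq _ (hl₀.trans_le hM)
      rw [hkM] at h2
      rw [h2]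
    · rw [key N hN le_rfl hgt.le (Or.inl rfl), if_neg hgt.not_ge]
      have := tangentGapPrim_nonneg hp hpt (hl₀.trans_le hN) hu hD0 hD'
      linarith

end Gap

lemma setIntegral_Ioo_affine_comb {f g : ℝ → ℝ} {α β : ℝ} (h : α ≤ β)
    (hf : IntegrableOn f (Ioo α β)) (hg : IntegrableOn g (Ioo α β)) (A B C : ℝ) :
    ∫ x in Ioo α β, (A * f x + B - C * g x)
      = A * (∫ x in Ioo α β, f x) + B * (β - α) - C * ∫ x in Ioo α β, g x := by
  have h1 : IntegrableOn (fun x => A * f x + B) (Ioo α β) :=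
    (hf.const_mul A).add (integrable_const B)
  rw [integral_sub h1 (hg.const_mul C), integral_add (hf.const_mul A) (integrable_const B),
    integral_const_mul, integral_const_mul]
  simp [h]
  ring

section RealWeight

variable {p D t s : ℝ} {v : ℝ → ℝ} {a b : ℝ}

lemma setIntegral_tangentGap_indicator_nonpos (hp : 1 < p) (hD : 1 < D) {k : ℝ} (hk0 : 0 < k)
    (hk1 : k < 1) (hk : k ^ p = D * (1 - p * (1 - k)))
    (hv0 : ∀ x, 0 ≤ v x) (hvm : Measurable v) (hv : Integrable v)
    (hvp : Integrable fun x => v x ^ p) (hab : a < b)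
    (hRH : ∀ α β l, a ≤ α → α < β → β ≤ b → 0 < l → ∫ x in Ioo α β, v x = l * (β - α) →
      ∫ x in Ioo α β, v x ^ p ≤ D * l ^ p * (β - α))
    {l : ℝ} (hl : 0 < l) (hvl : ∫ x in Ioo a b, v x ≤ l * (b - a)) :
    ∫ x in Ioo a b, (if k * l ≤ v x then tangentGap p D l (v x) else 0) ≤ 0 := by
  have hint : ∀ α β, IntegrableOn (fun x => tangentGap p D l (v x)) (Ioo α β) := fun α β =>
    (hvp.integrableOn.add (integrable_const _)).sub (hv.integrableOn.const_mul _)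
  have hlp : l ^ p = l ^ (p - 1) * l := by rw [← Real.rpow_add_one hl.ne']; ring_nf
  refine setIntegral_nonpos_of_average_eq hv hab hvl (hint a b) ?_ ?_ ?_ ?_
  · exact (hint a b).indicator (measurableSet_le measurable_const hvm)
  · intro x
    split_ifs with h
    · exact le_rfl
    · exact tangentGap_nonneg hp hD hk0 hk1 hk hl (hv0 x) (not_le.1 h).le
  · intro x hx
    split_ifs with h
    · exact tangentGap_nonpos hp hD hk0 hk hl h hx
    · exact le_rfl
  · intro α β h1 h2 h3 h4
    have h5 := hRH α β l h1 h2 h3 hl h4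
    have h6 : ∫ x in Ioo α β, tangentGap p D l (v x)
        = (∫ x in Ioo α β, v x ^ p) + (p - 1) * D * l ^ p * (β - α)
          - p * D * l ^ (p - 1) * ∫ x in Ioo α β, v x := by
      rw [← one_mul (∫ x in Ioo α β, v x ^ p), ← setIntegral_Ioo_affine_comb h2.le
        hvp.integrableOn hv.integrableOn]
      simp only [tangentGap, one_mul]
    rw [h6, h4, hlp] at *
    nlinarith

lemma integrable_tangentGap_prod {k : ℝ} (hvm : Measurable v) (hv : Integrable v)
    (hvp : Integrable fun x => v x ^ p) {l₀ N : ℝ} (hl₀ : 0 < l₀) :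
    Integrable (Function.uncurry fun x l =>
      if k * l ≤ v x then tangentGap p D l (v x) * l ^ (t - p - 1) else 0)
      ((volume.restrict (Ioo a b)).prod (volume.restrict (Ioc l₀ N))) := by
  have hr : ∀ r : ℝ, ContinuousOn (fun l : ℝ => l ^ r) (Icc l₀ N) := fun r x hx =>
    (Real.continuousAt_rpow_const x r
      (Or.inl (hl₀.trans_le hx.1).ne')).continuousWithinAt
  have hint : ∀ f : ℝ → ℝ, ContinuousOn f (Icc l₀ N) →
      Integrable f (volume.restrict (Ioc l₀ N)) := fun f hf =>
    hf.integrableOn_Icc.mono_set Ioc_subset_Icc_self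
  have h1 : Integrable (fun z : ℝ × ℝ => v z.1 ^ p * z.2 ^ (t - p - 1))
      ((volume.restrict (Ioo a b)).prod (volume.restrict (Ioc l₀ N))) :=
    Integrable.mul_prod (f := fun x => v x ^ p) (g := fun l => l ^ (t - p - 1))
      hvp.integrableOn (hint _ (hr _))
  have h2 : Integrable (fun z : ℝ × ℝ => (1 : ℝ) * ((p - 1) * D * z.2 ^ p * z.2 ^ (t - p - 1)))
      ((volume.restrict (Ioo a b)).prod (volume.restrict (Ioc l₀ N))) :=
    Integrable.mul_prod (f := fun _ => (1 : ℝ))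
      (g := fun l => (p - 1) * D * l ^ p * l ^ (t - p - 1)) (integrable_const _)
      (hint _ ((continuousOn_const.mul (hr _)).mul (hr _)))
  have h3 : Integrable (fun z : ℝ × ℝ => v z.1 * (p * D * z.2 ^ (p - 1) * z.2 ^ (t - p - 1)))
      ((volume.restrict (Ioo a b)).prod (volume.restrict (Ioc l₀ N))) :=
    Integrable.mul_prod (f := v) (g := fun l => p * D * l ^ (p - 1) * l ^ (t - p - 1))
      hv.integrableOn (hint _ ((continuousOn_const.mul (hr _)).mul (hr _)))
  have hS : MeasurableSet {z : ℝ × ℝ | k * z.2 ≤ v z.1} :=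
    measurableSet_le (measurable_const.mul measurable_snd) (hvm.comp measurable_fst)
  refine (((h1.add h2).sub h3).indicator hS).congr (ae_of_all _ fun z => ?_)
  simp only [Set.indicator, Function.uncurry, mem_ofPred_eq, Pi.add_apply, Pi.sub_apply,
    tangentGap]
  split_ifs
  · ring
  · rfl

lemma integrableOn_truncated_rpow (hv0 : ∀ x, 0 ≤ v x) (hvm : Measurable v) (ht : 0 ≤ t)
    (a b M : ℝ) : IntegrableOn (fun x => if v x ≤ M then v x ^ t else 0) (Ioo a b) := by
  refine Measure.integrableOn_of_bounded (M := |M| ^ t) (by simp) ?_ ?_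
  · exact (Measurable.ite (measurableSet_le hvm measurable_const)
      (hvm.pow_const t) measurable_const).aestronglyMeasurable
  · refine ae_of_all _ fun x => ?_
    split_ifs with h
    · rw [Real.norm_of_nonneg (Real.rpow_nonneg (hv0 x) _)]
      exact Real.rpow_le_rpow (hv0 x) (h.trans (le_abs_self M)) ht
    · rw [norm_zero]
      positivity

lemma setIntegral_truncated_rpow_le (hp : 1 < p) (hpt : p < t) (hts : t < s) (hD : 1 < D)
    (hkp : ((s - 1) / s) ^ p = D * (1 - p * (1 - (s - 1) / s)))
    (hv0 : ∀ x, 0 ≤ v x) (hvm : Measurable v) (hv : Integrable v)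
    (hvp : Integrable fun x => v x ^ p) (hab : a < b)
    (hRH : ∀ α β l, a ≤ α → α < β → β ≤ b → 0 < l → ∫ x in Ioo α β, v x = l * (β - α) →
      ∫ x in Ioo α β, v x ^ p ≤ D * l ^ p * (β - α))
    {l₀ : ℝ} (hl₀ : 0 < l₀) (hvl : ∫ x in Ioo a b, v x = l₀ * (b - a)) {N : ℝ} (hN : l₀ ≤ N) :
    ∫ x in Ioo a b, (if v x ≤ (s - 1) / s * N then v x ^ t else 0)
      ≤ ((s - 1) / s) ^ t * (s / (s - t)) * l₀ ^ t * (b - a) := by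
  have ht : 0 < t := by linarith
  have ht1 : 0 < t - 1 := by linarith
  have htp : 0 < t - p := by linarith
  have hs : 0 < s := by linarith
  have hs1 : 0 < s - 1 := by linarith
  have hst : 0 < s - t := by linarith
  have hp1 : 0 < p - 1 := by linarith
  have hk0 : 0 < (s - 1) / s := by positivity
  have hk1 : (s - 1) / s < 1 := by rw [div_lt_one hs]; linarith
  have hD' := le_of_critical_exponent hp hpt hts hkp
  have hslope := fun l hl => tangentGapPrim_slope (l := l) hp hpt hts hkp hl
  set k := (s - 1) / s with hk
  set q := D * p * (p - 1) * (s - t) / (s * t * (t - p) * (t - 1)) / k ^ t with hqdef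
  have hkt : 0 < k ^ t := by positivity
  have hq0 : 0 < q := by positivity
  have hq : ∀ l, 0 < l → tangentGapPrim p D t l (k * l) = q * (k * l) ^ t := by
    intro l hl
    rw [hslope l hl, Real.mul_rpow hk0.le hl.le, hqdef]
    field_simp
  set f : ℝ → ℝ → ℝ := fun x l =>
    if k * l ≤ v x then tangentGap p D l (v x) * l ^ (t - p - 1) else 0 with hf
  have hfint : Integrable (Function.uncurry f)
      ((volume.restrict (Ioo a b)).prod (volume.restrict (Ioc l₀ N))) :=
    integrable_tangentGap_prod hvm hv hvp hl₀
  have hswap : ∫ x in Ioo a b, ∫ l in Ioc l₀ N, f x l ≤ 0 := by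
    rw [integral_integral_swap hfint]
    refine setIntegral_nonpos measurableSet_Ioc fun l hl => ?_
    have hl0 : 0 < l := hl₀.trans hl.1
    have h1 := setIntegral_tangentGap_indicator_nonpos hp hD hk0 hk1 hkp hv0 hvm hv hvp hab hRH
      hl0 (by rw [hvl]; exact mul_le_mul_of_nonneg_right hl.1.le (by linarith))
    have h2 : ∀ x, f x l = (if k * l ≤ v x then tangentGap p D l (v x) else 0)
        * l ^ (t - p - 1) := by
      intro x
      simp only [hf, ite_mul, zero_mul]
    simp only [h2]
    rw [integral_mul_const]
    exact mul_nonpos_of_nonpos_of_nonneg h1 (Real.rpow_nonneg hl0.le _)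
  have hprim : IntegrableOn (fun x => tangentGapPrim p D t l₀ (v x)) (Ioo a b) :=
    (((hvp.integrableOn.const_mul _).div_const _).add (integrable_const _)).sub
      (((hv.integrableOn.const_mul _).mul_const _).div_const _)
  have hprim_eq : ∫ x in Ioo a b, tangentGapPrim p D t l₀ (v x)
      = l₀ ^ (t - p) * (∫ x in Ioo a b, v x ^ p) / (t - p) + (p - 1) * D * l₀ ^ t / t * (b - a)
        - p * D * (∫ x in Ioo a b, v x) * l₀ ^ (t - 1) / (t - 1) := by
    have := setIntegral_Ioo_affine_comb hab.le hvp.integrableOn hv.integrableOn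
      (l₀ ^ (t - p) / (t - p)) ((p - 1) * D * l₀ ^ t / t) (p * D * l₀ ^ (t - 1) / (t - 1))
    convert this using 1
    · refine integral_congr_ae (ae_of_all _ fun x => ?_)
      simp only [tangentGapPrim]
      ring
    · ring
  have htrunc : IntegrableOn (fun x => if v x ≤ k * N then q * v x ^ t else 0) (Ioo a b) := by
    have := (integrableOn_truncated_rpow hv0 hvm ht.le a b (k * N)).const_mul q
    simp only [mul_ite, mul_zero] at this
    exact this
  have hle : ∫ x in Ioo a b, ((if v x ≤ k * N then q * v x ^ t else 0)
      - tangentGapPrim p D t l₀ (v x)) ≤ ∫ x in Ioo a b, ∫ l in Ioc l₀ N, f x l :=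
    integral_mono (htrunc.sub hprim) hfint.integral_prod_left fun x =>
      le_integral_tangentGap_indicator hp hpt hD hk0 hk1 hkp hD' hq hl₀ hN (hv0 x)
  rw [integral_sub htrunc hprim, hprim_eq, hvl] at hle
  have hX2 := hRH a b l₀ le_rfl hab le_rfl hl₀ hvl
  have e1 : l₀ ^ t = l₀ ^ (t - p) * l₀ ^ p := by rw [← Real.rpow_add hl₀]; ring_nf
  have e2 : l₀ ^ (t - 1) = l₀ ^ (t - p) * l₀ ^ p / l₀ := by
    rw [← e1, Real.rpow_sub_one hl₀.ne']
  have h3 : l₀ ^ (t - p) * (∫ x in Ioo a b, v x ^ p) / (t - p)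
      ≤ l₀ ^ (t - p) * (D * l₀ ^ p * (b - a)) / (t - p) := by gcongr
  have h4 : ∀ x, (if v x ≤ k * N then q * v x ^ t else 0)
      = q * (if v x ≤ k * N then v x ^ t else 0) := by
    intro x
    simp only [mul_ite, mul_zero]
  simp only [h4] at hle
  rw [integral_const_mul] at hle
  refine le_of_mul_le_mul_left ?_ hq0
  have h5 : q * (k ^ t * (s / (s - t)) * l₀ ^ t * (b - a))
      = l₀ ^ (t - p) * (D * l₀ ^ p * (b - a)) / (t - p) + (p - 1) * D * l₀ ^ t / t * (b - a)
        - p * D * (l₀ * (b - a)) * l₀ ^ (t - 1) / (t - 1) := by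
    rw [hqdef, e1, e2]
    field_simp
    ring
  rw [h5]
  linarith

lemma lintegral_rpow_le (hp : 1 < p) (hpt : p < t) (hts : t < s) (hD : 1 < D)
    (hkp : ((s - 1) / s) ^ p = D * (1 - p * (1 - (s - 1) / s)))
    (hv0 : ∀ x, 0 ≤ v x) (hvm : Measurable v) (hv : Integrable v)
    (hvp : Integrable fun x => v x ^ p) (hab : a < b)
    (hRH : ∀ α β l, a ≤ α → α < β → β ≤ b → 0 < l → ∫ x in Ioo α β, v x = l * (β - α) →
      ∫ x in Ioo α β, v x ^ p ≤ D * l ^ p * (β - α))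
    {l₀ : ℝ} (hl₀ : 0 < l₀) (hvl : ∫ x in Ioo a b, v x = l₀ * (b - a)) :
    ∫⁻ x in Ioo a b, ENNReal.ofReal (v x ^ t)
      ≤ ENNReal.ofReal (((s - 1) / s) ^ t * (s / (s - t)) * l₀ ^ t * (b - a)) := by
  have ht : 0 < t := by linarith
  have hk0 : 0 < (s - 1) / s := div_pos (by linarith) (by linarith)
  set k := (s - 1) / s with hk
  set φ : ℕ → ℝ → ℝ := fun n x => if v x ≤ k * (l₀ + n) then v x ^ t else 0 with hφ
  have hφ0 : ∀ n x, 0 ≤ φ n x := by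
    intro n x
    simp only [hφ]
    split_ifs
    · exact Real.rpow_nonneg (hv0 x) _
    · exact le_rfl
  have hφm : ∀ n, Measurable (φ n) := fun n =>
    Measurable.ite (measurableSet_le hvm measurable_const) (hvm.pow_const t) measurable_const
  have hmono : Monotone fun n x => ENNReal.ofReal (φ n x) := by
    intro m n hmn x
    refine ENNReal.ofReal_le_ofReal ?_
    by_cases h : v x ≤ k * (l₀ + m)
    · have h' : v x ≤ k * (l₀ + n) := by
        refine h.trans (mul_le_mul_of_nonneg_left ?_ hk0.le)
        gcongr
      simp only [hφ, if_pos h, if_pos h', le_refl]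
    · have : φ m x = 0 := if_neg h
      rw [this]
      exact hφ0 n x
  have hsup : ∀ x, ENNReal.ofReal (v x ^ t) = ⨆ n, ENNReal.ofReal (φ n x) := by
    intro x
    refine le_antisymm ?_ (iSup_le fun n => ENNReal.ofReal_le_ofReal ?_)
    · obtain ⟨n, hn⟩ := exists_nat_ge (v x / k)
      refine le_iSup_of_le n (ENNReal.ofReal_le_ofReal ?_)
      have : v x ≤ k * (l₀ + n) := by
        rw [div_le_iff₀ hk0] at hn
        nlinarith [mul_pos hk0 hl₀]
      simp only [hφ, if_pos this, le_refl]
    · simp only [hφ]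
      split_ifs
      · exact le_rfl
      · exact Real.rpow_nonneg (hv0 x) _
  simp only [hsup]
  rw [lintegral_iSup (fun n => (hφm n).ennreal_ofReal) hmono]
  refine iSup_le fun n => ?_
  rw [← ofReal_integral_eq_lintegral_ofReal (integrableOn_truncated_rpow hv0 hvm ht.le a b _)
    (ae_of_all _ (hφ0 n))]
  exact ENNReal.ofReal_le_ofReal (setIntegral_truncated_rpow_le hp hpt hts hD hkp hv0 hvm hv hvp
    hab hRH hl₀ hvl (by simp))

end RealWeight

lemma avgE_le_ofReal_iff {f : ℝ → ℝ≥0∞} {a b c : ℝ} (hab : a < b) (hc : 0 ≤ c) :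
    avgE f a b ≤ ENNReal.ofReal c ↔ ∫⁻ x in Ioo a b, f x ≤ ENNReal.ofReal (c * (b - a)) := by
  have h : ENNReal.ofReal (b - a) ≠ 0 := by simpa using hab
  rw [avgE, ENNReal.div_le_iff h ENNReal.ofReal_ne_top, ENNReal.ofReal_mul hc]

lemma avgE_eq_ofReal_div {f : ℝ → ℝ≥0∞} {a b c : ℝ} (hab : a < b)
    (h : ∫⁻ x in Ioo a b, f x = ENNReal.ofReal c) :
    avgE f a b = ENNReal.ofReal (c / (b - a)) := by
  rw [avgE, h, ENNReal.ofReal_div_of_pos (sub_pos.2 hab)]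

/-- Higher integrability of a reverse Hölder weight, for exponents strictly larger than `p`. -/
lemma avgE_rpow_le_of_memRH {p δ s t A B : ℝ} (hp : 1 < p) (hpt : p < t) (hts : t < s)
    (hδ : 1 < δ) (hkp : ((s - 1) / s) ^ p = δ ^ p * (1 - p * (1 - (s - 1) / s)))
    {w : ℝ → ℝ≥0∞} (hw : MemRH p δ A B w) {a b : ℝ} (ha : A ≤ a) (hab : a < b) (hb : b ≤ B) :
    (avgE (fun x => w x ^ t) a b) ^ (1 / t)
      ≤ ENNReal.ofReal (((s - 1) / s) * (s / (s - t)) ^ (1 / t)) * avgE w a b := by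
  obtain ⟨hm, hfin, hRH⟩ := hw
  have hp0 : 0 < p := by linarith
  have ht : 0 < t := by linarith
  have hba : 0 < b - a := sub_pos.2 hab
  have hk0 : 0 < (s - 1) / s := div_pos (by linarith) (by linarith)
  have hst : 0 < s / (s - t) := div_pos (by linarith) (by linarith)
  have hwfin : ∀ α β, a ≤ α → β ≤ b → ∫⁻ x in Ioo α β, w x ≠ ⊤ := fun α β h1 h2 =>
    ne_top_of_le_ne_top hfin
      (lintegral_mono_set (Ioo_subset_Ioo (ha.trans h1) (h2.trans hb)))
  have havgfin : avgE w a b ≠ ⊤ :=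
    ENNReal.div_ne_top (hwfin a b le_rfl le_rfl) (by simpa using hab)
  have hpfin : ∫⁻ x in Ioo a b, w x ^ p ≠ ⊤ := by
    have h := hRH a b ha hab hb
    have h2 : ENNReal.ofReal δ ^ p * avgE w a b ^ p ≠ ⊤ :=
      ENNReal.mul_ne_top (ENNReal.rpow_ne_top_of_nonneg hp0.le ENNReal.ofReal_ne_top)
        (ENNReal.rpow_ne_top_of_nonneg hp0.le havgfin)
    intro htop
    rw [avgE, htop, ENNReal.top_div_of_ne_top ENNReal.ofReal_ne_top] at h
    exact h2 (top_le_iff.1 h)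
  rcases eq_or_ne (∫⁻ x in Ioo a b, w x) 0 with hz | hnz
  · have hae := (lintegral_eq_zero_iff hm).1 hz
    have : ∫⁻ x in Ioo a b, w x ^ t = 0 := by
      rw [lintegral_eq_zero_iff (hm.pow_const t)]
      filter_upwards [hae] with x hx
      simp only [Pi.zero_apply] at hx ⊢
      rw [hx, ENNReal.zero_rpow_of_pos ht]
    rw [avgE, this, ENNReal.zero_div, ENNReal.zero_rpow_of_pos (by positivity)]
    exact zero_le
  have hae : ∀ᵐ x ∂volume.restrict (Ioo a b), w x < ⊤ :=
    ae_lt_top hm (hwfin a b le_rfl le_rfl)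
  set v : ℝ → ℝ := (Ioo a b).indicator fun x => (w x).toReal with hv
  have hvm : Measurable v := hm.ennreal_toReal.indicator measurableSet_Ioo
  have hv0 : ∀ x, 0 ≤ v x := fun x => indicator_nonneg (fun _ _ => ENNReal.toReal_nonneg) x
  have hvin : ∀ x ∈ Ioo a b, v x = (w x).toReal := fun x hx => indicator_of_mem hx _
  have hvint : Integrable v := by
    have h1 : IntegrableOn (fun x => (w x).toReal) (Ioo a b) :=
      integrable_toReal_of_lintegral_ne_top hm.aemeasurable (hwfin a b le_rfl le_rfl)
    exact h1.integrable_indicator measurableSet_Ioo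
  have hvpint : Integrable fun x => v x ^ p := by
    have h1 : IntegrableOn (fun x => (w x ^ p).toReal) (Ioo a b) :=
      integrable_toReal_of_lintegral_ne_top (hm.pow_const p).aemeasurable hpfin
    refine (h1.integrable_indicator measurableSet_Ioo).congr (ae_of_all _ fun x => ?_)
    by_cases hx : x ∈ Ioo a b
    · simp only [hv, indicator_of_mem hx, ENNReal.toReal_rpow]
    · simp only [hv, indicator_of_notMem hx, Real.zero_rpow hp0.ne']
  have hlint : ∀ α β, a ≤ α → β ≤ b →
      ∫⁻ x in Ioo α β, w x = ENNReal.ofReal (∫ x in Ioo α β, v x) := by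
    intro α β h1 h2
    have hsub := Ioo_subset_Ioo h1 h2
    rw [setIntegral_congr_fun measurableSet_Ioo fun x hx => hvin x (hsub hx),
      integral_toReal hm.aemeasurable (ae_mono (Measure.restrict_mono_set _ hsub) hae),
      ENNReal.ofReal_toReal (hwfin α β h1 h2)]
  have hlintp : ∀ α β, a ≤ α → β ≤ b →
      ∫⁻ x in Ioo α β, w x ^ p = ENNReal.ofReal (∫ x in Ioo α β, v x ^ p) := by
    intro α β h1 h2
    have hsub := Ioo_subset_Ioo h1 h2
    have hae' : ∀ᵐ x ∂volume.restrict (Ioo α β), w x ^ p < ⊤ := by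
      filter_upwards [ae_mono (Measure.restrict_mono_set _ hsub) hae] with x hx
      exact ENNReal.rpow_lt_top_of_nonneg hp0.le hx.ne
    rw [setIntegral_congr_fun (g := fun x => (w x ^ p).toReal) measurableSet_Ioo fun x hx => by
        simp only [hvin x (hsub hx), ENNReal.toReal_rpow],
      integral_toReal (hm.pow_const p).aemeasurable hae', ENNReal.ofReal_toReal]
    exact ne_top_of_le_ne_top hpfin (lintegral_mono_set hsub)
  have hRH' : ∀ α β l, a ≤ α → α < β → β ≤ b → 0 < l → ∫ x in Ioo α β, v x = l * (β - α) →
      ∫ x in Ioo α β, v x ^ p ≤ δ ^ p * l ^ p * (β - α) := by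
    intro α β l h1 h2 h3 hl h4
    have hβα : 0 < β - α := sub_pos.2 h2
    have h5 := hRH α β (ha.trans h1) h2 (h3.trans hb)
    have h6 : avgE w α β = ENNReal.ofReal l := by
      rw [avgE_eq_ofReal_div h2 (hlint α β h1 h3), h4, mul_div_cancel_right₀ _ hβα.ne']
    rw [h6, ENNReal.ofReal_rpow_of_pos hl, ENNReal.ofReal_rpow_of_pos (by linarith),
      ← ENNReal.ofReal_mul (by positivity), avgE_le_ofReal_iff h2 (by positivity),
      hlintp α β h1 h3, ENNReal.ofReal_le_ofReal_iff (by positivity)] at h5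
    exact h5
  set l₀ := (∫ x in Ioo a b, v x) / (b - a) with hl₀
  have havg : avgE w a b = ENNReal.ofReal l₀ :=
    avgE_eq_ofReal_div hab (hlint a b le_rfl le_rfl)
  have hl₀pos : 0 < l₀ := by
    refine div_pos ?_ hba
    rw [hlint a b le_rfl le_rfl] at hnz
    simpa using hnz
  have key := lintegral_rpow_le hp hpt hts (Real.one_lt_rpow hδ hp0) hkp hv0 hvm hvint hvpint hab
    hRH' hl₀pos (by rw [hl₀]; field_simp)
  have hwt : ∫⁻ x in Ioo a b, w x ^ t = ∫⁻ x in Ioo a b, ENNReal.ofReal (v x ^ t) := by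
    refine lintegral_congr_ae ?_
    filter_upwards [hae, ae_restrict_mem measurableSet_Ioo] with x hx hxm
    rw [hvin x hxm, ← ENNReal.ofReal_rpow_of_nonneg ENNReal.toReal_nonneg ht.le,
      ENNReal.ofReal_toReal hx.ne]
  have hK : ((s - 1) / s) ^ t * (s / (s - t)) * l₀ ^ t
      = (((s - 1) / s) * (s / (s - t)) ^ (1 / t) * l₀) ^ t := by
    rw [Real.mul_rpow (by positivity) hl₀pos.le, Real.mul_rpow hk0.le (by positivity),
      ← Real.rpow_mul hst.le, one_div_mul_cancel ht.ne', Real.rpow_one]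
  rw [← hwt, ← avgE_le_ofReal_iff hab (by positivity), hK] at key
  rw [havg, ← ENNReal.ofReal_mul (by positivity)]
  calc _ ≤ (ENNReal.ofReal ((((s - 1) / s) * (s / (s - t)) ^ (1 / t) * l₀) ^ t)) ^ (1 / t) :=
        ENNReal.rpow_le_rpow key (by positivity)
    _ = _ := by
        rw [ENNReal.ofReal_rpow_of_nonneg (by positivity) (by positivity),
          ← Real.rpow_mul (by positivity), mul_one_div_cancel ht.ne', Real.rpow_one]

section PowerWeight

lemma lintegral_Ioo_ofReal_rpow {a b e : ℝ} (ha : 0 ≤ a) (hab : a ≤ b) (he : -1 < e) :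
    ∫⁻ x in Ioo a b, ENNReal.ofReal (x ^ e)
      = ENNReal.ofReal ((b ^ (e + 1) - a ^ (e + 1)) / (e + 1)) := by
  have hint : IntegrableOn (fun x : ℝ => x ^ e) (Ioo a b) :=
    ((intervalIntegrable_iff_integrableOn_Ioc_of_le hab).1
      (intervalIntegral.intervalIntegrable_rpow' he)).mono_set Ioo_subset_Ioc_self
  rw [← ofReal_integral_eq_lintegral_ofReal hint, ← integral_Ioc_eq_integral_Ioo,
    ← intervalIntegral.integral_of_le hab, integral_rpow (Or.inl he)]
  filter_upwards [ae_restrict_mem measurableSet_Ioo] with x hx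
  exact Real.rpow_nonneg (ha.trans hx.1.le) _

lemma avgE_ofReal_rpow_rpow {a b r q : ℝ} (ha : 0 ≤ a) (hab : a < b) (hq : 0 ≤ q)
    (hrq : r * q < 1) :
    avgE (fun x => ENNReal.ofReal (x ^ (-r)) ^ q) a b
      = ENNReal.ofReal ((b ^ (1 - r * q) - a ^ (1 - r * q)) / (1 - r * q) / (b - a)) := by
  refine avgE_eq_ofReal_div hab ?_
  rw [show 1 - r * q = -(r * q) + 1 by ring,
    ← lintegral_Ioo_ofReal_rpow ha hab.le (by linarith)]
  refine setLIntegral_congr_fun measurableSet_Ioo fun x hx => ?_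
  have hx0 : 0 ≤ x := ha.trans hx.1.le
  simp only [ENNReal.ofReal_rpow_of_nonneg (Real.rpow_nonneg hx0 _) hq, ← Real.rpow_mul hx0,
    neg_mul]

lemma avgE_ofReal_rpow {a b r : ℝ} (ha : 0 ≤ a) (hab : a < b) (hr : r < 1) :
    avgE (fun x => ENNReal.ofReal (x ^ (-r))) a b
      = ENNReal.ofReal ((b ^ (1 - r) - a ^ (1 - r)) / (1 - r) / (b - a)) := by
  have := avgE_ofReal_rpow_rpow (q := 1) ha hab zero_le_one (by rwa [mul_one])
  simpa only [ENNReal.rpow_one, mul_one] using this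

lemma rpow_sub_rpow_le {a b r p : ℝ} (ha : 0 ≤ a) (hab : a < b) (hp : 1 ≤ p)
    (hr1 : r < 1) (hrp : r * p < 1) :
    b ^ (1 - r * p) - a ^ (1 - r * p)
      ≤ (b - a) * ((b ^ (1 - r) - a ^ (1 - r)) / (b - a)) ^ p := by
  have hb : 0 < b := ha.trans_lt hab
  have hba : 0 < b - a := sub_pos.2 hab
  have e1 : ∀ x : ℝ, 0 ≤ x → x ^ (1 - r) = x * x ^ (-r) := by
    intro x hx
    rw [sub_eq_add_neg, Real.rpow_add' hx (by linarith), Real.rpow_one]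
  have e2 : ∀ x : ℝ, 0 ≤ x → x ^ (1 - r * p) = x * (x ^ (-r)) ^ p := by
    intro x hx
    rw [← Real.rpow_mul hx, sub_eq_add_neg, Real.rpow_add' hx (by linarith), Real.rpow_one,
      neg_mul]
  set y := (b ^ (1 - r) - a ^ (1 - r)) / (b - a) with hy
  have hy0 : 0 ≤ y :=
    div_nonneg (sub_nonneg.2 (Real.rpow_le_rpow ha hab.le (by linarith))) hba.le
  have hconv := (convexOn_rpow hp).2 (Real.rpow_nonneg ha (-r)) hy0
    (div_nonneg ha hb.le) (div_nonneg hba.le hb.le) (by field_simp; ring)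
  have hcomb : (a / b) • a ^ (-r) + ((b - a) / b) • y = b ^ (-r) := by
    rw [hy, e1 a ha, e1 b hb.le, smul_eq_mul, smul_eq_mul]
    field_simp
    ring
  rw [hcomb, smul_eq_mul, smul_eq_mul] at hconv
  rw [e2 a ha, e2 b hb.le]
  have h := mul_le_mul_of_nonneg_left hconv hb.le
  have h2 : b * (a / b * (a ^ (-r)) ^ p + (b - a) / b * y ^ p)
      = a * (a ^ (-r)) ^ p + (b - a) * y ^ p := by field_simp
  linarith

lemma memRH_ofReal_rpow {p δ r : ℝ} (hp : 1 < p) (hδ : 0 ≤ δ) (hr1 : r < 1) (hrp : r * p < 1)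
    (hδr : (1 - r) ^ p = δ ^ p * (1 - r * p)) :
    MemRH p δ 0 1 fun x => ENNReal.ofReal (x ^ (-r)) := by
  refine ⟨(measurable_id.pow_const _).ennreal_ofReal, ?_, ?_⟩
  · rw [lintegral_Ioo_ofReal_rpow le_rfl zero_le_one (by linarith)]
    exact ENNReal.ofReal_ne_top
  · intro a b ha hab hb
    have hba : 0 < b - a := sub_pos.2 hab
    have hr0 : 0 < 1 - r := by linarith
    have hrp0 : 0 < 1 - r * p := by linarith
    have hy0 : 0 ≤ b ^ (1 - r) - a ^ (1 - r) :=
      sub_nonneg.2 (Real.rpow_le_rpow ha hab.le hr0.le)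
    rw [avgE_ofReal_rpow_rpow ha hab (by linarith) hrp, avgE_ofReal_rpow ha hab hr1,
      ENNReal.ofReal_rpow_of_nonneg hδ (by linarith),
      ENNReal.ofReal_rpow_of_nonneg (by positivity) (by linarith),
      ← ENNReal.ofReal_mul (by positivity)]
    refine ENNReal.ofReal_le_ofReal ?_
    rw [div_right_comm _ (1 - r), Real.div_rpow (by positivity) hr0.le, hδr, div_div,
      div_le_iff₀ (by positivity)]
    refine (rpow_sub_rpow_le ha hab hp.le hr1 hrp).trans_eq ?_
    have : δ ^ p ≠ 0 := by
      intro h0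
      rw [h0, zero_mul] at hδr
      exact (Real.rpow_pos_of_pos hr0 p).ne' hδr
    field_simp

end PowerWeight

theorem statement7 (p δ ts t : ℝ) (hp : 1 < p) (hδ : 1 < δ)
    (hts1 : p < ts) (hts : (δ * ts / (ts - 1)) ^ p * ((ts - p) / ts) = 1)
    (ht1 : p ≤ t) (ht2 : t < ts) :
    (∀ A B : ℝ, A < B → ∀ w : ℝ → ℝ≥0∞, MemRH p δ A B w →
      ∀ a b, A ≤ a → a < b → b ≤ B →
        (avgE (fun x => w x ^ t) a b) ^ (1 / t)
          ≤ ENNReal.ofReal (((ts - 1) / ts) * (ts / (ts - t)) ^ (1 / t)) * avgE w a b) ∧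
    (∀ C : ℝ, C < ((ts - 1) / ts) * (ts / (ts - t)) ^ (1 / t) →
      ∃ w : ℝ → ℝ≥0∞, MemRH p δ 0 1 w ∧ ∃ a b : ℝ, 0 ≤ a ∧ a < b ∧ b ≤ 1 ∧
        ENNReal.ofReal C * avgE w a b < (avgE (fun x => w x ^ t) a b) ^ (1 / t)) := by
  have hp0 : 0 < p := by linarith
  have ht0 : 0 < t := by linarith
  have hs0 : 0 < ts := by linarith
  have hs1 : 0 < ts - 1 := by linarith
  have hsp : 0 < ts - p := by linarith
  have hst : 0 < ts - t := by linarith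
  have hδ0 : 0 < δ := by linarith
  have hk0 : 0 < (ts - 1) / ts := by positivity
  have hδs : ((ts - 1) / ts) ^ p = δ ^ p * ((ts - p) / ts) := by
    have h1 : δ * ts / (ts - 1) = δ / ((ts - 1) / ts) := by field_simp
    rw [h1, Real.div_rpow hδ0.le hk0.le] at hts
    have : 0 < ((ts - 1) / ts) ^ p := by positivity
    field_simp at hts ⊢
    linarith
  have hkp : ((ts - 1) / ts) ^ p = δ ^ p * (1 - p * (1 - (ts - 1) / ts)) := by
    rw [hδs]
    congr 1
    field_simp
    ring
  constructor
  · intro A B hAB w hw a b ha hab hb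
    rcases ht1.eq_or_lt with rfl | hpt
    · have hK : (ts - 1) / ts * (ts / (ts - p)) ^ (1 / p) = δ := by
        have h1 : (ts - 1) / ts = δ * ((ts - p) / ts) ^ (1 / p) := by
          rw [← Real.rpow_left_inj hk0.le (by positivity) hp0.ne', hδs,
            Real.mul_rpow hδ0.le (by positivity), ← Real.rpow_mul (by positivity),
            one_div_mul_cancel hp0.ne', Real.rpow_one]
        rw [h1, mul_assoc, ← Real.mul_rpow (by positivity) (by positivity),
          show (ts - p) / ts * (ts / (ts - p)) = 1 by field_simp, Real.one_rpow, mul_one]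
      rw [hK]
      calc _ ≤ (ENNReal.ofReal δ ^ p * avgE w a b ^ p) ^ (1 / p) :=
            ENNReal.rpow_le_rpow (hw.2.2 a b ha hab hb) (by positivity)
        _ = _ := by
            rw [← ENNReal.mul_rpow_of_nonneg _ _ hp0.le, ← ENNReal.rpow_mul,
              mul_one_div_cancel hp0.ne', ENNReal.rpow_one]
    · exact avgE_rpow_le_of_memRH hp hpt ht2 hδ hkp hw ha hab hb
  · intro C hC
    have hr1 : 1 / ts < 1 := by rw [div_lt_one hs0]; linarith
    have hrp : 1 / ts * p < 1 := by rw [one_div_mul_eq_div, div_lt_one hs0]; exact hts1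
    have hrt : 1 / ts * t < 1 := by rw [one_div_mul_eq_div, div_lt_one hs0]; exact ht2
    refine ⟨fun x => ENNReal.ofReal (x ^ (-(1 / ts))),
      memRH_ofReal_rpow hp hδ0.le hr1 hrp ?_, 0, 1, le_rfl, zero_lt_one, le_rfl, ?_⟩
    · rw [one_sub_div hs0.ne', hδs, one_div_mul_eq_div, one_sub_div hs0.ne']
    · rw [avgE_ofReal_rpow le_rfl zero_lt_one hr1,
        avgE_ofReal_rpow_rpow le_rfl zero_lt_one ht0.le hrt, Real.one_rpow, Real.one_rpow,
        Real.zero_rpow (by linarith), Real.zero_rpow (by linarith), one_sub_div hs0.ne',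
        one_div_mul_eq_div, one_sub_div hs0.ne']
      simp only [sub_zero, div_one]
      rw [one_div_div, one_div_div, ENNReal.ofReal_rpow_of_pos (by positivity),
        ← ENNReal.ofReal_mul' (by positivity), ENNReal.ofReal_lt_ofReal_iff (by positivity)]
      calc C * (ts / (ts - 1)) < (ts - 1) / ts * (ts / (ts - t)) ^ (1 / t) * (ts / (ts - 1)) := by
            gcongr
        _ = (ts / (ts - t)) ^ (1 / t) := by field_simp
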